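/- Let A ⊆ F_q be a finite set such that |(A+A) ∩ (a·G + b)| ≤ |G|^{1/2} for every subfield G of F_q, every a ∈ F_q∖{0}, and every b ∈ F_q. Then max{|A + A|, |A² + A²|} ≫ |A|^{1 + 1/42}. -/

import Mathlib

open Pointwise Finset

/-- Cauchy–Schwarz for the fibres of a map. -/
lemma card_sq_le_image_mul_collisions {α β : Type*} [DecidableEq β] (s : Finset α) (f : α → β) :
    s.card ^ 2 ≤ (s.image f).card * ((s ×ˢ s).filter (fun z => f z.1 = f z.2)).card := by
  classical
  have h1 : s.card = ∑ b ∈ s.image f, (s.filter (fun a => f a = b)).card :=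
    Finset.card_eq_sum_card_fiberwise (fun x hx => by simpa using ⟨x, hx, rfl⟩)
  have h2 : ((s ×ˢ s).filter (fun z => f z.1 = f z.2)).card
      = ∑ b ∈ s.image f, (s.filter (fun a => f a = b)).card ^ 2 := by
    rw [Finset.card_eq_sum_card_fiberwise (f := fun z => f z.1) (t := s.image f)]
    · refine Finset.sum_congr rfl fun b _ => ?_
      rw [sq, ← Finset.card_product]
      congr 1
      ext ⟨x, y⟩
      simp only [mem_filter, mem_product]
      constructor
      · rintro ⟨⟨⟨hx, hy⟩, h⟩, rfl⟩
        exact ⟨⟨hx, rfl⟩, hy, h.symm⟩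
      · rintro ⟨⟨hx, rfl⟩, hy, h⟩
        exact ⟨⟨⟨hx, hy⟩, h.symm⟩, rfl⟩
    · intro x hx
      simp only [coe_filter, mem_product, Set.mem_ofPred_eq] at hx
      simpa using ⟨x.1, hx.1.1, rfl⟩
  rw [h2]
  calc s.card ^ 2 = (∑ b ∈ s.image f, (s.filter (fun a => f a = b)).card) ^ 2 := by rw [← h1]
    _ ≤ _ := sq_sum_le_card_mul_sum_sq

/-- Some dilate `x + ξ y`, `ξ ∈ G`, takes at least `|B|²/2` values. -/
lemma exists_dilate {F : Type*} [Field F] [DecidableEq F] (B G : Finset F) (hG : G.Nonempty)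
    (h : B.card ^ 2 ≤ G.card) :
    ∃ ξ ∈ G, B.card ^ 2 ≤ 2 * ((B ×ˢ B).image (fun z => z.1 + ξ * z.2)).card := by
  classical
  by_contra! hcon
  set n := B.card with hn
  let W : F → Finset ((F × F) × (F × F)) := fun ξ =>
    ((B ×ˢ B) ×ˢ (B ×ˢ B)).filter (fun z => z.1.1 + ξ * z.1.2 = z.2.1 + ξ * z.2.2)
  have hpos : 0 < n := by
    obtain ⟨ξ, hξ⟩ := hG
    have := hcon ξ hξ
    by_contra h0
    have : n = 0 := by omega
    simp [this] at *
  have hlow : ∀ ξ ∈ G, 2 * n ^ 2 < (W ξ).card := by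
    intro ξ hξ
    have h1 := card_sq_le_image_mul_collisions (B ×ˢ B) (fun z : F × F => z.1 + ξ * z.2)
    have h2 := hcon ξ hξ
    rw [card_product, ← hn] at h1
    change (n * n) ^ 2 ≤ _ * (W ξ).card at h1
    by_contra! h3
    have hp : 0 < n ^ 2 := by positivity
    have : (n * n) ^ 2 = n ^ 2 * n ^ 2 := by ring
    nlinarith
  have hsum : ∑ ξ ∈ G, (W ξ).card ≤ G.card * n ^ 2 + n ^ 4 := by
    let D := ((B ×ˢ B) ×ˢ (B ×ˢ B)).filter (fun z : (F × F) × (F × F) => z.1 = z.2)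
    let U := ((B ×ˢ B) ×ˢ (B ×ˢ B)).filter (fun z : (F × F) × (F × F) => z.1.2 ≠ z.2.2)
    have hD : D.card ≤ n ^ 2 := by
      have : D.card ≤ (B ×ˢ B).card := by
        refine Finset.card_le_card_of_injOn (fun z => z.1) ?_ ?_
        · intro z hz
          have := (mem_filter.1 hz).1
          exact (mem_product.1 this).1
        · intro z hz w hw hzw
          have h1 := (mem_filter.1 hz).2
          have h2 := (mem_filter.1 hw).2
          ext1
          · exact hzw
          · rw [← h1, ← h2]; exact hzw
      rw [card_product] at this
      rw [sq]; exact this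
    have hU : ∑ ξ ∈ G, ((W ξ).filter (fun z => z.1.2 ≠ z.2.2)).card ≤ n ^ 4 := by
      rw [← Finset.card_sigma]
      have : n ^ 4 = ((B ×ˢ B) ×ˢ (B ×ˢ B)).card := by
        simp only [card_product]; rw [← hn]; ring
      rw [this]
      refine Finset.card_le_card_of_injOn (fun z => z.2) ?_ ?_
      · intro z hz
        simp only [coe_sigma, Set.mem_sigma_iff, mem_coe] at hz
        exact (mem_filter.1 (mem_filter.1 hz.2).1).1
      · rintro ⟨ξ, z⟩ hz ⟨η, w⟩ hw hzw
        simp only [coe_sigma, Set.mem_sigma_iff, mem_coe] at hz hw hzw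
        subst hzw
        have h1 := (mem_filter.1 (mem_filter.1 hz.2).1).2
        have h2 := (mem_filter.1 (mem_filter.1 hw.2).1).2
        have h3 := (mem_filter.1 hz.2).2
        have h4 : (ξ - η) * (z.1.2 - z.2.2) = 0 := by linear_combination h1 - h2
        rcases mul_eq_zero.1 h4 with h5 | h5
        · rw [sub_eq_zero.1 h5]
        · exact absurd (sub_eq_zero.1 h5) h3
    have hsplit : ∀ ξ ∈ G, (W ξ).card ≤ n ^ 2 + ((W ξ).filter (fun z => z.1.2 ≠ z.2.2)).card := by
      intro ξ _
      have h1 := Finset.card_filter_add_card_filter_not (s := W ξ) (fun z => z.1.2 ≠ z.2.2)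
      have h2 : ((W ξ).filter (fun z => ¬ z.1.2 ≠ z.2.2)) ⊆ D := by
        intro z hz
        have ha := (mem_filter.1 (mem_filter.1 hz).1)
        have hb := (mem_filter.1 hz).2
        push Not at hb
        refine mem_filter.2 ⟨ha.1, ?_⟩
        have hc := ha.2
        rw [hb] at hc
        exact Prod.ext (add_right_cancel hc) hb
      have := card_le_card h2
      omega
    calc _ ≤ ∑ ξ ∈ G, (n ^ 2 + ((W ξ).filter (fun z => z.1.2 ≠ z.2.2)).card) :=
          Finset.sum_le_sum hsplit
      _ ≤ _ := by rw [Finset.sum_add_distrib]; simp only [sum_const, smul_eq_mul]; omega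
  have h5 : ∑ ξ ∈ G, 2 * n ^ 2 < ∑ ξ ∈ G, (W ξ).card := Finset.sum_lt_sum_of_nonempty hG hlow
  simp only [sum_const, smul_eq_mul] at h5
  have : n ^ 4 = n ^ 2 * n ^ 2 := by ring
  nlinarith

/-- The quotient set. -/
def quotSet {F : Type*} [Field F] (B : Finset F) : Set F :=
  {x | ∃ b1 ∈ B, ∃ b2 ∈ B, ∃ b3 ∈ B, ∃ b4 ∈ B, b3 ≠ b4 ∧ x * (b3 - b4) = b1 - b2}

lemma card_of_not_mem_quotSet {F : Type*} [Field F] [DecidableEq F] (B : Finset F) (u v : F)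
    (hu : u ≠ 0) (h : v / u ∉ quotSet B) :
    ((B ×ˢ B).image (fun z => u * z.1 + v * z.2)).card = B.card ^ 2 := by
  rw [Finset.card_image_of_injOn, card_product, sq]
  rintro ⟨x, y⟩ hz ⟨x', y'⟩ hw hzw
  simp only [coe_product, Set.mem_prod, mem_coe] at hz hw hzw
  by_cases hy : y = y'
  · subst hy
    have := mul_left_cancel₀ hu (add_right_cancel hzw)
    rw [this]
  · exfalso
    apply h
    refine ⟨x', hw.1, x, hz.1, y, hz.2, y', hw.2, hy, ?_⟩
    field_simp
    linear_combination hzw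

lemma quotSet_subfield {F : Type*} [Field F] [Finite F] (B : Finset F) (a : F)
    (hB : 2 ≤ B.card)
    (h1 : ∀ r ∈ quotSet B, r + 1 ∈ quotSet B)
    (h2 : ∀ r ∈ quotSet B, ∀ p ∈ B, ∀ p' ∈ B, a + p ≠ 0 → a + p' ≠ 0 →
      r * ((a + p) / (a + p')) ∈ quotSet B) :
    ∃ G : Subfield F, (G : Set F) = quotSet B := by
  classical
  obtain ⟨c, hc, d, hd, hcd⟩ := Finset.one_lt_card.1 hB
  have hzero : (0 : F) ∈ quotSet B := ⟨c, hc, c, hc, c, hc, d, hd, hcd, by simp⟩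
  let W : AddSubmonoid F :=
    { carrier := {x | ∀ r ∈ quotSet B, r + x ∈ quotSet B}
      zero_mem' := by intro r hr; simpa using hr
      add_mem' := by
        intro x y hx hy r hr
        rw [← add_assoc]
        exact hy _ (hx _ hr) }
  have hW1 : (1 : F) ∈ W := h1
  have hWR : ∀ x ∈ W, x ∈ quotSet B := fun x hx => by simpa using hx 0 hzero
  have hneg : ∀ x ∈ W, -x ∈ W := by
    intro x hx
    obtain ⟨p, hp⟩ := CharP.exists F
    have hp0 : p ≠ 0 := CharP.char_ne_zero_of_finite F p
    have : -x = (p - 1) • x := by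
      have h0 : ((p : ℕ) : F) = 0 := CharP.cast_eq_zero F p
      rw [nsmul_eq_mul, Nat.cast_sub (by omega), h0]; simp
    rw [this]
    exact W.nsmul_mem hx _
  have hH : ∀ p ∈ B, ∀ p' ∈ B, a + p ≠ 0 → a + p' ≠ 0 → ∀ x ∈ W,
      (a + p) / (a + p') * x ∈ W := by
    intro p hp p' hp' h0 h0' x hx r hr
    have e1 := h2 r hr p' hp' p hp h0' h0
    have e2 := h2 _ (hx _ e1) p hp p' hp' h0 h0'
    convert e2 using 1
    field_simp
  let M : Subring F :=
    { carrier := {y | ∀ x ∈ W, y * x ∈ W}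
      zero_mem' := by intro x _; rw [zero_mul]; exact W.zero_mem
      one_mem' := by intro x hx; rwa [one_mul]
      add_mem' := by
        intro y z hy hz x hx
        rw [add_mul]; exact W.add_mem (hy x hx) (hz x hx)
      mul_mem' := by
        intro y z hy hz x hx
        rw [mul_assoc]; exact hy _ (hz _ hx)
      neg_mem' := by
        intro y hy x hx
        rw [neg_mul]; exact hneg _ (hy x hx) }
  have hinv : ∀ x ∈ M, x⁻¹ ∈ M := by
    intro x hx
    by_cases hx0 : x = 0
    · simp [hx0]
    have : Fintype F := Fintype.ofFinite F
    have e : x⁻¹ = x ^ (Fintype.card F - 2) := by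
      have hq : 1 < Fintype.card F := Fintype.one_lt_card
      have := FiniteField.pow_card_sub_one_eq_one x hx0
      apply inv_eq_of_mul_eq_one_right
      rw [← pow_succ', ← this]
      congr 1
      omega
    rw [e]; exact M.pow_mem hx _
  obtain ⟨p0, hp0, hp00⟩ : ∃ p0 ∈ B, a + p0 ≠ 0 := by
    by_cases h : a + c = 0
    · refine ⟨d, hd, fun h' => hcd ?_⟩
      exact add_left_cancel (h.trans h'.symm)
    · exact ⟨c, hc, h⟩
  have hBM : ∀ p ∈ B, (a + p) / (a + p0) ∈ M := by
    intro p hp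
    by_cases h : a + p = 0
    · rw [h, zero_div]; exact M.zero_mem
    · exact fun x hx => hH p hp p0 hp0 h hp00 x hx
  refine ⟨{ M with inv_mem' := hinv }, ?_⟩
  ext x
  constructor
  · intro hx
    have : x * 1 ∈ W := hx 1 hW1
    rw [mul_one] at this
    exact hWR x this
  · rintro ⟨b1, hb1, b2, hb2, b3, hb3, b4, hb4, hne, hx⟩
    have hs : b3 - b4 ≠ 0 := sub_ne_zero.2 hne
    have e : x = ((a + b1) / (a + p0) - (a + b2) / (a + p0)) *
        ((a + b3) / (a + p0) - (a + b4) / (a + p0))⁻¹ := by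
      have : x = (b1 - b2) / (b3 - b4) := by rw [← hx]; field_simp
      rw [this, ← sub_div, ← sub_div]
      have e1 : a + b1 - (a + b2) = b1 - b2 := by ring
      have e2 : a + b3 - (a + b4) = b3 - b4 := by ring
      rw [e1, e2]
      field_simp
    rw [e]
    exact M.mul_mem (M.sub_mem (hBM _ hb1) (hBM _ hb2))
      (hinv _ (M.sub_mem (hBM _ hb3) (hBM _ hb4)))

lemma core {F : Type*} [Field F] [Fintype F] [DecidableEq F] (B : Finset F) (a : F)
    (hB : 2 ≤ B.card)
    (hG : ∀ (G : Subfield F) (d b : F), d ≠ 0 → (∀ x ∈ B, ∃ g ∈ G, x = d * g + b) →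
      B.card ^ 2 ≤ Nat.card G) (X : ℝ)
    (h4 : ∀ b1 ∈ B, ∀ b2 ∈ B, ∀ b3 ∈ B, ∀ b4 ∈ B, b3 ≠ b4 →
      (((B ×ˢ B).image (fun z => (b3 - b4) * z.1 + (b1 - b2) * z.2)).card : ℝ) ≤ X)
    (h6 : ∀ b1 ∈ B, ∀ b2 ∈ B, ∀ b3 ∈ B, ∀ b4 ∈ B, b3 ≠ b4 →
      (((B ×ˢ B).image
        (fun z => (b3 - b4) * z.1 + ((b1 - b2) + (b3 - b4)) * z.2)).card : ℝ) ≤ X)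
    (h8 : ∀ b1 ∈ B, ∀ b2 ∈ B, ∀ b3 ∈ B, ∀ b4 ∈ B, b3 ≠ b4 → b1 ≠ b2 →
      ∀ p ∈ B, ∀ p' ∈ B, a + p ≠ 0 → a + p' ≠ 0 →
      (((B ×ˢ B).image
        (fun z => ((b3 - b4) * (a + p')) * z.1 + ((b1 - b2) * (a + p)) * z.2)).card : ℝ) ≤ X) :
    (B.card : ℝ) ^ 2 ≤ 2 * X := by
  have hX : 0 ≤ X := by
    obtain ⟨c, hc, d, hd, hcd⟩ := Finset.one_lt_card.1 hB
    exact le_trans (Nat.cast_nonneg _) (h4 c hc d hd c hc d hd hcd)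
  by_cases hadd : ∀ r ∈ quotSet B, r + 1 ∈ quotSet B
  swap
  · push Not at hadd
    obtain ⟨r, ⟨b1, hb1, b2, hb2, b3, hb3, b4, hb4, hne, hx⟩, hr⟩ := hadd
    have hs : b3 - b4 ≠ 0 := sub_ne_zero.2 hne
    have := h6 b1 hb1 b2 hb2 b3 hb3 b4 hb4 hne
    rw [card_of_not_mem_quotSet B _ _ hs] at this
    · push_cast at this; linarith
    · convert hr using 1
      rw [← hx]; field_simp
  by_cases hmul : ∀ r ∈ quotSet B, ∀ p ∈ B, ∀ p' ∈ B, a + p ≠ 0 → a + p' ≠ 0 →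
      r * ((a + p) / (a + p')) ∈ quotSet B
  swap
  · push Not at hmul
    obtain ⟨r, hr0, p, hp, p', hp', hp0, hp0', hr⟩ := hmul
    obtain ⟨b1, hb1, b2, hb2, b3, hb3, b4, hb4, hne, hx⟩ := hr0
    have hs : b3 - b4 ≠ 0 := sub_ne_zero.2 hne
    have hne' : b1 ≠ b2 := by
      rintro rfl
      have : r = 0 := by
        rw [sub_self] at hx
        exact (mul_eq_zero.1 hx).resolve_right hs
      apply hr
      rw [this, zero_mul]
      exact ⟨b1, hb1, b1, hb1, b3, hb3, b4, hb4, hne, by simp⟩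
    have := h8 b1 hb1 b2 hb2 b3 hb3 b4 hb4 hne hne' p hp p' hp' hp0 hp0'
    rw [card_of_not_mem_quotSet B _ _ (mul_ne_zero hs hp0')] at this
    · push_cast at this; linarith
    · convert hr using 1
      rw [← hx]; field_simp
  obtain ⟨G, hGR⟩ := quotSet_subfield B a hB hadd hmul
  obtain ⟨c, hc, d, hd, hcd⟩ := Finset.one_lt_card.1 hB
  have hcd0 : c - d ≠ 0 := sub_ne_zero.2 hcd
  have hcard := hG G (c - d) d hcd0 (by
    intro x hx
    refine ⟨(x - d) / (c - d), ?_, by field_simp; ring⟩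
    have : (x - d) / (c - d) ∈ (G : Set F) := by
      rw [hGR]
      exact ⟨x, hx, d, hd, c, hc, d, hd, hcd, by field_simp⟩
    exact this)
  classical
  let GG : Finset F := (G : Set F).toFinset
  have hGG : GG.card = Nat.card G := by
    rw [Set.toFinset_card, ← Nat.card_eq_fintype_card]; rfl
  obtain ⟨ξ, hξ, hle⟩ := exists_dilate B GG ⟨0, by simp [GG]⟩ (by rw [hGG]; exact hcard)
  have hξ' : ξ ∈ quotSet B := by rw [← hGR]; simpa [GG] using hξ
  obtain ⟨b1, hb1, b2, hb2, b3, hb3, b4, hb4, hne, hx⟩ := hξ'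
  have hs : b3 - b4 ≠ 0 := sub_ne_zero.2 hne
  have h := h4 b1 hb1 b2 hb2 b3 hb3 b4 hb4 hne
  have e : (B ×ˢ B).image (fun z => (b3 - b4) * z.1 + (b1 - b2) * z.2)
      = ((B ×ˢ B).image (fun z => z.1 + ξ * z.2)).image (fun w => (b3 - b4) * w) := by
    rw [Finset.image_image]
    congr 1
    funext z
    simp only [Function.comp]
    rw [← hx]; ring
  rw [e, Finset.card_image_of_injective _ (mul_right_injective₀ hs)] at h
  have : ((B.card ^ 2 : ℕ) : ℝ) ≤ _ := Nat.cast_le.2 hle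
  push_cast at this
  linarith

lemma list_sum_bound {F : Type*} [Field F] [DecidableEq F] (V : Finset F) (L : ℝ) (hL : 0 ≤ L)
    (l : List (Finset F))
    (h : ∀ Z ∈ l, ∀ Y : Finset F, ((Y + Z).card : ℝ) ≤ L * (Y + V).card) (Y : Finset F) :
    ((Y + l.sum).card : ℝ) ≤ L ^ l.length * (Y + l.length • V).card := by
  induction l generalizing Y with
  | nil => simp
  | cons Z l ih =>
    have h1 := ih (fun Z' hZ' => h Z' (List.mem_cons_of_mem _ hZ')) (Y + Z)
    have h2 := h Z (List.mem_cons_self) (Y + l.length • V)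
    rw [List.sum_cons, List.length_cons, succ_nsmul, ← add_assoc, ← add_assoc, pow_succ]
    rw [add_right_comm] at h2
    calc _ ≤ _ := h1
      _ ≤ L ^ l.length * (L * (Y + l.length • V + V).card) := by gcongr
      _ = _ := by ring

lemma card_half_le_sq {F : Type*} [Field F] [DecidableEq F] (A : Finset F) :
    A.card ≤ 2 * (A.image (fun x => x ^ 2)).card := by
  refine Finset.card_le_mul_card_image A 2 fun b hb => ?_
  obtain ⟨x, hx, rfl⟩ := mem_image.1 hb
  have : A.filter (fun y => y ^ 2 = x ^ 2) ⊆ {x, -x} := by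
    intro y hy
    have := (mem_filter.1 hy).2
    rw [sq_eq_sq_iff_eq_or_eq_neg] at this
    simpa using this
  exact (card_le_card this).trans Finset.card_le_two

lemma card_scale {F : Type*} [Field F] [DecidableEq F] (A : Finset F) (t u v : F) (ht : t ≠ 0) :
    ((t * u) • A + (t * v) • A).card = (u • A + v • A).card := by
  rw [mul_smul, mul_smul, ← smul_add, card_smul_finset₀ ht]

section bounds
variable {F : Type*} [Field F] [DecidableEq F] (A : Finset F) (M : ℝ)

lemma diff_bound (hA : A.Nonempty)
    (hE : ((A.image (fun x => x ^ 2) + A.image (fun x => x ^ 2)).card : ℝ) ≤ M) (n : ℕ) :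
    ((n • (A.image (fun x => x ^ 2) - A.image (fun x => x ^ 2))).card : ℝ)
      ≤ (2 * (M / A.card)) ^ (2 * n) * A.card := by
  set E := A.image (fun x => x ^ 2) with hEdef
  have hEne : E.Nonempty := hA.image _
  have h := pluennecke_ruzsa_inequality_nsmul_sub_nsmul_add hEne E n n
  have h' : ((n • E - n • E).card : ℝ) ≤ ((E + E).card / E.card : ℝ) ^ (n + n) * E.card := by
    have : (((n • E - n • E).card : ℚ≥0) : ℝ) ≤
      ((((E + E).card / E.card : ℚ≥0) ^ (n + n) * E.card : ℚ≥0) : ℝ) := by exact_mod_cast h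
    simpa using this
  have hN : (0 : ℝ) < A.card := by exact_mod_cast hA.card_pos
  have hEp : (0 : ℝ) < E.card := by exact_mod_cast hEne.card_pos
  have h1 : (A.card : ℝ) ≤ 2 * E.card := by exact_mod_cast card_half_le_sq A
  have h2 : (E.card : ℝ) ≤ A.card := by exact_mod_cast card_image_le
  have hM : 0 ≤ M := le_trans (Nat.cast_nonneg _) hE
  have h3 : ((E + E).card / E.card : ℝ) ≤ 2 * (M / A.card) := by
    rw [← mul_div_assoc, div_le_div_iff₀ hEp hN]
    nlinarith
  rw [nsmul_sub, two_mul n]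
  refine h'.trans ?_
  gcongr

/-- Number of representations. -/
def reps (p : F) : Finset F := A.filter (fun x => p - x ∈ A)

lemma reps_good (hA : A.Nonempty) (hS : ((A + A).card : ℝ) ≤ M)
    (p : F) (hp : (A.card : ℝ) ^ 2 ≤ 2 * M * (reps A p).card) (h2 : (2 : F) ≠ 0)
    (Y : Finset F) :
    ((Y + (2 * p) • A).card : ℝ) ≤ 2 * (M / A.card) ^ 2 *
      (Y + (A.image (fun x => x ^ 2) - A.image (fun x => x ^ 2))).card := by
  set E := A.image (fun x => x ^ 2) with hEdef
  have hN : (1 : ℝ) ≤ A.card := by exact_mod_cast hA.card_pos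
  have hNM : (A.card : ℝ) ≤ M := le_trans (by exact_mod_cast card_le_card_add_right hA) hS
  have hMp : 0 < M := by linarith
  have hK : 1 ≤ M / A.card := by rw [le_div_iff₀ (by linarith)]; linarith
  by_cases hp0 : p = 0
  · subst hp0
    have h1 : (Y + (2 * 0 : F) • A).card ≤ Y.card := by
      rw [mul_zero, zero_smul_finset hA, add_zero]
    have h3 : Y.card ≤ (Y + (E - E)).card :=
      card_le_card_add_right (((hA.image _).sub (hA.image _)))
    have h4 : ((Y + (2 * 0 : F) • A).card : ℝ) ≤ (Y + (E - E)).card := by exact_mod_cast h1.trans h3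
    refine h4.trans (le_mul_of_one_le_left (Nat.cast_nonneg _) ?_)
    nlinarith
  have hq : (2 * p) ≠ 0 := mul_ne_zero h2 hp0
  have htri := ruzsa_triangle_inequality_add_add_add Y ((2 * p) • reps A p) ((2 * p) • A)
  rw [card_smul_finset₀ hq, ← smul_add, card_smul_finset₀ hq] at htri
  have hc1 : (reps A p + A).card ≤ (A + A).card :=
    card_le_card (add_subset_add_right (filter_subset _ _))
  have hc2 : (Y + (2 * p) • reps A p).card ≤ (Y + (E - E)).card := by
    refine Finset.card_le_card_of_injOn (fun w => w - p ^ 2) ?_ (fun x _ y _ h => sub_left_injective h)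
    intro w hw
    obtain ⟨y, hy, z, hz, rfl⟩ := mem_add.1 hw
    obtain ⟨x, hx, rfl⟩ := mem_smul_finset.1 hz
    have hx' := mem_filter.1 hx
    refine mem_coe.2 (mem_add.2 ⟨y, hy, x ^ 2 - (p - x) ^ 2, ?_, ?_⟩)
    · exact sub_mem_sub (mem_image_of_mem _ hx'.1) (mem_image_of_mem _ hx'.2)
    · simp only [smul_eq_mul]; ring
  have htri' : ((Y + (2 * p) • A).card : ℝ) * (reps A p).card ≤ (Y + (E - E)).card * M := by
    calc _ ≤ ((Y + (2 * p) • reps A p).card : ℝ) * (reps A p + A).card := by exact_mod_cast htri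
      _ ≤ _ := by
        gcongr
        exact le_trans (by exact_mod_cast hc1) hS
  rw [div_pow, ← mul_div_assoc, div_mul_eq_mul_div, le_div_iff₀ (by positivity)]
  calc _ ≤ ((Y + (2 * p) • A).card : ℝ) * (2 * M * (reps A p).card) := by gcongr
    _ = 2 * M * (((Y + (2 * p) • A).card : ℝ) * (reps A p).card) := by ring
    _ ≤ 2 * M * ((Y + (E - E)).card * M) := by gcongr
    _ = _ := by ring

lemma reps_good_neg (hA : A.Nonempty) (hS : ((A + A).card : ℝ) ≤ M)
    (p : F) (hp : (A.card : ℝ) ^ 2 ≤ 2 * M * (reps A p).card) (h2 : (2 : F) ≠ 0)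
    (Y : Finset F) :
    ((Y + -((2 * p) • A)).card : ℝ) ≤ 2 * (M / A.card) ^ 2 *
      (Y + (A.image (fun x => x ^ 2) - A.image (fun x => x ^ 2))).card := by
  have h := reps_good A M hA hS p hp h2 (-Y)
  rw [← card_neg, ← card_neg (-Y + _)] at h
  simpa only [neg_add, neg_neg, neg_sub] using h

/-- A list of `n` signed dilates by popular sums. -/
lemma signed_sum_bound (hA : A.Nonempty) (hS : ((A + A).card : ℝ) ≤ M)
    (hE : ((A.image (fun x => x ^ 2) + A.image (fun x => x ^ 2)).card : ℝ) ≤ M)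
    (h2 : (2 : F) ≠ 0) (l : List (Finset F))
    (hl : ∀ Z ∈ l, ∃ p : F, (A.card : ℝ) ^ 2 ≤ 2 * M * (reps A p).card ∧
      (Z = (2 * p) • A ∨ Z = -((2 * p) • A))) :
    (l.sum.card : ℝ) ≤ (8 * (M / A.card) ^ 4) ^ l.length * A.card := by
  have hM : 0 ≤ M := le_trans (Nat.cast_nonneg _) hE
  have h := list_sum_bound (A.image (fun x => x ^ 2) - A.image (fun x => x ^ 2))
    (2 * (M / A.card) ^ 2) (by positivity) l (by
      intro Z hZ Y
      obtain ⟨p, hp, rfl | rfl⟩ := hl Z hZ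
      · exact reps_good A M hA hS p hp h2 Y
      · exact reps_good_neg A M hA hS p hp h2 Y) 0
  rw [zero_add, zero_add] at h
  refine h.trans ?_
  calc _ ≤ (2 * (M / A.card) ^ 2) ^ l.length *
        ((2 * (M / A.card)) ^ (2 * l.length) * A.card) := by
        gcongr
        exact diff_bound A M hA hE _
    _ = _ := by
      rw [pow_mul, ← mul_assoc, ← mul_pow]
      congr 2
      ring

lemma exists_popular (hA : A.Nonempty) (hS : ((A + A).card : ℝ) ≤ M) :
    ∃ a ∈ A, ∃ B ⊆ A, (A.card : ℝ) ≤ 2 * B.card ∧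
      ∀ b ∈ B, (A.card : ℝ) ^ 2 ≤ 2 * M * (reps A (a + b)).card := by
  classical
  have hN : (0 : ℝ) < A.card := by exact_mod_cast hA.card_pos
  have hNM : (A.card : ℝ) ≤ M := le_trans (by exact_mod_cast card_le_card_add_right hA) hS
  have hMp : 0 < M := by linarith
  let P : F → Prop := fun p => (A.card : ℝ) ^ 2 ≤ 2 * M * (reps A p).card
  by_contra! hcon
  have hlt : ∀ a ∈ A, 2 * ((A.filter (fun b => P (a + b))).card : ℝ) < A.card := by
    intro a ha
    by_contra! h
    obtain ⟨b, hb, hb'⟩ := hcon a ha (A.filter (fun b => P (a + b))) (filter_subset _ _) h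
    exact absurd (mem_filter.1 hb).2 (not_le.2 hb')
  have hunpop : ∑ a ∈ A, ((A.filter (fun b => ¬ P (a + b))).card : ℝ) ≤ (A.card : ℝ) ^ 2 / 2 := by
    have e : ∑ a ∈ A, (A.filter (fun b => ¬ P (a + b))).card
        = ∑ s ∈ (A + A).filter (fun s => ¬ P s), (reps A s).card := by
      rw [← card_sigma, ← card_sigma]
      refine Finset.card_nbij' (fun z => ⟨z.1 + z.2, z.1⟩) (fun z => ⟨z.2, z.1 - z.2⟩) ?_ ?_ ?_ ?_
      · rintro ⟨x, y⟩ h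
        simp only [coe_sigma, Set.mem_sigma_iff, mem_coe, mem_filter, reps] at h ⊢
        exact ⟨⟨add_mem_add h.1 h.2.1, h.2.2⟩, h.1, by simpa using h.2.1⟩
      · rintro ⟨x, y⟩ h
        simp only [coe_sigma, Set.mem_sigma_iff, mem_coe, mem_filter, reps] at h ⊢
        exact ⟨h.2.1, h.2.2, by simpa using h.1.2⟩
      · rintro ⟨x, y⟩ h
        simp
      · rintro ⟨x, y⟩ h
        simp
    have e' : ∑ a ∈ A, ((A.filter (fun b => ¬ P (a + b))).card : ℝ)
        = ∑ s ∈ (A + A).filter (fun s => ¬ P s), ((reps A s).card : ℝ) := by exact_mod_cast e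
    rw [e']
    calc _ ≤ ∑ s ∈ (A + A).filter (fun s => ¬ P s), (A.card : ℝ) ^ 2 / (2 * M) := by
          refine sum_le_sum fun s hs => ?_
          have := not_le.1 (mem_filter.1 hs).2
          rw [le_div_iff₀ (by positivity)]
          linarith
      _ = (((A + A).filter (fun s => ¬ P s)).card : ℝ) * ((A.card : ℝ) ^ 2 / (2 * M)) := by
          rw [sum_const, nsmul_eq_mul]
      _ ≤ M * ((A.card : ℝ) ^ 2 / (2 * M)) := by
          gcongr
          exact le_trans (by exact_mod_cast card_filter_le _ _) hS
      _ = _ := by field_simp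
  have h1 : ∀ a ∈ A, (A.card : ℝ) / 2 < ((A.filter (fun b => ¬ P (a + b))).card : ℝ) := by
    intro a ha
    have h1 := Finset.card_filter_add_card_filter_not (s := A) (fun b => P (a + b))
    have h1' : ((A.filter (fun b => P (a + b))).card : ℝ)
      + (A.filter (fun b => ¬ P (a + b))).card = A.card := by exact_mod_cast h1
    have := hlt a ha
    linarith
  have h3 := sum_lt_sum_of_nonempty hA h1
  rw [sum_const, nsmul_eq_mul] at h3
  nlinarith

lemma image_card_le {B : Finset F} (hBA : B ⊆ A) (u v : F) :
    (((B ×ˢ B).image (fun z => u * z.1 + v * z.2)).card) ≤ (u • A + v • A).card := by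
  refine card_le_card fun w hw => ?_
  obtain ⟨⟨x, y⟩, hz, rfl⟩ := mem_image.1 hw
  have := mem_product.1 hz
  exact add_mem_add (smul_mem_smul_finset (hBA this.1)) (smul_mem_smul_finset (hBA this.2))

lemma sub_smul_subset (u v : F) : (u - v) • A ⊆ u • A + -(v • A) := by
  intro w hw
  obtain ⟨x, hx, rfl⟩ := mem_smul_finset.1 hw
  rw [sub_smul, sub_eq_add_neg]
  exact add_mem_add (smul_mem_smul_finset hx) (neg_mem_neg (smul_mem_smul_finset hx))

lemma add_smul_subset' (u v : F) : (u + v) • A ⊆ u • A + v • A := by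
  intro w hw
  obtain ⟨x, hx, rfl⟩ := mem_smul_finset.1 hw
  rw [add_smul]
  exact add_mem_add (smul_mem_smul_finset hx) (smul_mem_smul_finset hx)

end bounds

lemma main_bound {F : Type*} [Field F] [Fintype F] [DecidableEq F] (A : Finset F) (M : ℝ)
    (hA : A.Nonempty) (hS : ((A + A).card : ℝ) ≤ M)
    (hE : ((A.image (fun x => x ^ 2) + A.image (fun x => x ^ 2)).card : ℝ) ≤ M)
    (h2 : (2 : F) ≠ 0)
    (hG : ∀ (G : Subfield F) (d b : F), d ≠ 0 → 
      ((((A + A : Finset F) : Set F) ∩ ((fun g => d * g + b) '' (G : Set F))).ncard : ℝ)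
            ≤ Real.sqrt (Nat.card G)) :
    (A.card : ℝ) ≤ 2 ^ 21 * (M / A.card) ^ 24 := by
  have hN : (0 : ℝ) < A.card := by exact_mod_cast hA.card_pos
  have hNM : (A.card : ℝ) ≤ M := le_trans (by exact_mod_cast card_le_card_add_right hA) hS
  have hMp : 0 < M := by linarith
  obtain ⟨a, ha, B, hBA, hBcard, hpop⟩ := exists_popular A M hA hS
  set N : ℝ := (A.card : ℝ) with hNdef
  set K := M / N with hKdef
  have hK : 1 ≤ K := by rw [hKdef, le_div_iff₀ hN]; linarith
  by_cases hB2 : 2 ≤ B.card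
  swap
  · have h1 : (B.card : ℝ) ≤ 1 := by exact_mod_cast (by omega : B.card ≤ 1)
    have : 1 ≤ K ^ 24 := one_le_pow₀ hK
    nlinarith
  -- the four-term bound
  have H4 : ∀ b1 ∈ B, ∀ b2 ∈ B, ∀ b3 ∈ B, ∀ b4 ∈ B,
      (((b3 - b4) • A + (b1 - b2) • A).card : ℝ) ≤ (8 * K ^ 4) ^ 4 * N := by
    intro b1 h1 b2 h2' b3 h3 b4 h4
    have h := signed_sum_bound A M hA hS hE h2
      [(2 * (a + b3)) • A, -((2 * (a + b4)) • A), (2 * (a + b1)) • A, -((2 * (a + b2)) • A)]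
      (by
        simp only [List.mem_cons, List.not_mem_nil, or_false]
        rintro Z (rfl | rfl | rfl | rfl)
        exacts [⟨_, hpop b3 h3, Or.inl rfl⟩, ⟨_, hpop b4 h4, Or.inr rfl⟩,
          ⟨_, hpop b1 h1, Or.inl rfl⟩, ⟨_, hpop b2 h2', Or.inr rfl⟩])
    refine le_trans ?_ h
    rw [← card_scale A 2 _ _ h2]
    norm_cast
    refine card_le_card ?_
    have e1 : 2 * (b3 - b4) = 2 * (a + b3) - 2 * (a + b4) := by ring
    have e2 : 2 * (b1 - b2) = 2 * (a + b1) - 2 * (a + b2) := by ring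
    rw [e1, e2]
    simp only [List.sum_cons, List.sum_nil, add_zero]
    rw [← add_assoc]
    exact add_subset_add (sub_smul_subset A _ _) (sub_smul_subset A _ _)
  have H6 : ∀ b1 ∈ B, ∀ b2 ∈ B, ∀ b3 ∈ B, ∀ b4 ∈ B,
      (((b3 - b4) • A + ((b1 - b2) + (b3 - b4)) • A).card : ℝ) ≤ (8 * K ^ 4) ^ 6 * N := by
    intro b1 h1 b2 h2' b3 h3 b4 h4
    have h := signed_sum_bound A M hA hS hE h2
      [(2 * (a + b3)) • A, -((2 * (a + b4)) • A), (2 * (a + b1)) • A, -((2 * (a + b2)) • A),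
        (2 * (a + b3)) • A, -((2 * (a + b4)) • A)]
      (by
        simp only [List.mem_cons, List.not_mem_nil, or_false]
        rintro Z (rfl | rfl | rfl | rfl | rfl | rfl)
        exacts [⟨_, hpop b3 h3, Or.inl rfl⟩, ⟨_, hpop b4 h4, Or.inr rfl⟩,
          ⟨_, hpop b1 h1, Or.inl rfl⟩, ⟨_, hpop b2 h2', Or.inr rfl⟩,
          ⟨_, hpop b3 h3, Or.inl rfl⟩, ⟨_, hpop b4 h4, Or.inr rfl⟩])
    refine le_trans ?_ h
    rw [← card_scale A 2 _ _ h2]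
    norm_cast
    refine card_le_card ?_
    have e1 : 2 * (b3 - b4) = 2 * (a + b3) - 2 * (a + b4) := by ring
    have e2 : 2 * (b1 - b2) = 2 * (a + b1) - 2 * (a + b2) := by ring
    rw [mul_add, e1, e2]
    simp only [List.sum_cons, List.sum_nil, add_zero]
    rw [← add_assoc]
    refine add_subset_add (sub_smul_subset A _ _) ?_
    refine (add_smul_subset' A _ _).trans ?_
    rw [← add_assoc]
    exact add_subset_add (sub_smul_subset A _ _) (sub_smul_subset A _ _)
  have H2 : ∀ p ∈ B, ∀ p' ∈ B,
      (((a + p') • A + (a + p) • A).card : ℝ) ≤ (8 * K ^ 4) ^ 2 * N := by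
    intro p hp p' hp'
    have h := signed_sum_bound A M hA hS hE h2 [(2 * (a + p')) • A, (2 * (a + p)) • A]
      (by
        simp only [List.mem_cons, List.not_mem_nil, or_false]
        rintro Z (rfl | rfl)
        exacts [⟨_, hpop p' hp', Or.inl rfl⟩, ⟨_, hpop p hp, Or.inl rfl⟩])
    refine le_trans (le_of_eq ?_) h
    rw [← card_scale A 2 _ _ h2]
    simp only [List.sum_cons, List.sum_nil, add_zero]
  have hXle : (8 * K ^ 4) ^ 4 * N ≤ (8 * K ^ 4) ^ 6 * N := by
    gcongr
    · have : 1 ≤ K ^ 4 := one_le_pow₀ hK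
      linarith
    · norm_num
  have hc := core B a hB2 (by
      intro G d b hd hx
      have h := hG G d (a + b) hd
      have h3 : B.card ≤ (((A + A : Finset F) : Set F) ∩
          ((fun g => d * g + (a + b)) '' (G : Set F))).ncard := by
        have : B.card = ((fun x => a + x) '' (B : Set F)).ncard := by
          rw [Set.ncard_image_of_injective _ (add_right_injective a), Set.ncard_coe_finset]
        rw [this]
        refine Set.ncard_le_ncard ?_ (Set.toFinite _)
        rintro _ ⟨x, hxB, rfl⟩
        refine ⟨mem_coe.2 (add_mem_add ha (hBA hxB)), ?_⟩
        obtain ⟨g, hg, rfl⟩ := hx x hxB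
        exact ⟨g, hg, by ring⟩
      have h4 : (B.card : ℝ) ≤ Real.sqrt (Nat.card G) := le_trans (by exact_mod_cast h3) h
      have h5 := (Real.le_sqrt' (by exact_mod_cast (by omega : 0 < B.card))).1 h4
      exact_mod_cast h5)
    ((8 * K ^ 4) ^ 6 * N)
    (fun b1 h1 b2 h2 b3 h3 b4 h4 _ => le_trans (by exact_mod_cast image_card_le A hBA _ _)
      ((H4 b1 h1 b2 h2 b3 h3 b4 h4).trans hXle))
    (fun b1 h1 b2 h2 b3 h3 b4 h4 _ => le_trans (by exact_mod_cast image_card_le A hBA _ _)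
      (H6 b1 h1 b2 h2 b3 h3 b4 h4))
    (by
      intro b1 h1 b2 h2 b3 h3 b4 h4 hne hne' p hp p' hp' hp0 hp0'
      refine le_trans (Nat.cast_le.2 (image_card_le A hBA _ _)) ?_
      have hd : b1 - b2 ≠ 0 := sub_ne_zero.2 hne'
      have htri := ruzsa_triangle_inequality_add_add_add (((b3 - b4) * (a + p')) • A)
        (((b1 - b2) * (a + p')) • A) (((b1 - b2) * (a + p)) • A)
      rw [card_smul_finset₀ (mul_ne_zero hd hp0'), card_scale A (b1 - b2) _ _ hd,
        mul_comm (b3 - b4) (a + p'), mul_comm (b1 - b2) (a + p'), card_scale A (a + p') _ _ hp0',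
        mul_comm (a + p') (b3 - b4)] at htri
      have htri' : ((((b3 - b4) * (a + p')) • A + ((b1 - b2) * (a + p)) • A).card : ℝ) * N
          ≤ ((8 * K ^ 4) ^ 4 * N) * ((8 * K ^ 4) ^ 2 * N) := by
        refine le_trans (by rw [hNdef]; exact_mod_cast htri) (mul_le_mul
          (H4 b1 h1 b2 h2 b3 h3 b4 h4) (H2 p hp p' hp') (Nat.cast_nonneg _) (by positivity))
      refine le_of_mul_le_mul_right (htri'.trans (le_of_eq ?_)) hN
      ring)
  have h7 : N * N ≤ (2 ^ 21 * K ^ 24) * N := by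
    have : N * N ≤ 4 * (B.card : ℝ) ^ 2 := by nlinarith
    calc _ ≤ _ := this
      _ ≤ 4 * (2 * ((8 * K ^ 4) ^ 6 * N)) := by linarith
      _ = _ := by ring
  exact le_of_mul_le_mul_right h7 hN

theorem sum_square_sum_product_finite_fields :
    ∃ c : ℝ, 0 < c ∧
      ∀ (F : Type) [Field F] [Fintype F] [DecidableEq F] (A : Finset F),
        (∀ (G : Subfield F) (a b : F), a ≠ 0 →
          ((((A + A : Finset F) : Set F) ∩ ((fun g => a * g + b) '' (G : Set F))).ncard : ℝ)
            ≤ Real.sqrt (Nat.card G)) →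
        c * (A.card : ℝ) ^ ((43 : ℝ) / 42)
          ≤ max (((A + A).card : ℝ))
              (((A.image (fun x => x ^ 2) + A.image (fun x => x ^ 2)).card : ℝ)) := by
  refine ⟨1 / 2, by norm_num, ?_⟩
  intro F _ _ _ A hG
  rcases A.eq_empty_or_nonempty with rfl | hA
  · simp only [card_empty, Nat.cast_zero]
    rw [Real.zero_rpow (by norm_num), mul_zero]
    exact le_max_of_le_left (Nat.cast_nonneg _)
  set M : ℝ := max (((A + A).card : ℝ))
    (((A.image (fun x => x ^ 2) + A.image (fun x => x ^ 2)).card : ℝ)) with hM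
  have hS : ((A + A).card : ℝ) ≤ M := le_max_left _ _
  have hE : ((A.image (fun x => x ^ 2) + A.image (fun x => x ^ 2)).card : ℝ) ≤ M :=
    le_max_right _ _
  have hN : (1 : ℝ) ≤ A.card := by exact_mod_cast hA.card_pos
  have hNM : (A.card : ℝ) ≤ M := le_trans (by exact_mod_cast card_le_card_add_right hA) hS
  have hK : 1 ≤ M / A.card := by rw [le_div_iff₀ (by linarith)]; linarith
  have key : (A.card : ℝ) ≤ (2 * (M / A.card)) ^ 42 := by
    by_cases h2 : (2 : F) = 0
    · have hA1 : A.card ≤ 1 := by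
        by_contra! h
        obtain ⟨x, hx, y, hy, hxy⟩ := Finset.one_lt_card.1 h
        have hchar : CharP F 2 := CharTwo.of_one_ne_zero_of_two_eq_zero one_ne_zero h2
        have hp : Fact (Nat.Prime 2) := ⟨Nat.prime_two⟩
        have h3 := hG ⊥ (y - x) (x + x) (sub_ne_zero.2 hxy.symm)
        rw [Subfield.card_bot F 2] at h3
        have h4 : 2 ≤ (((A + A : Finset F) : Set F) ∩
            ((fun g => (y - x) * g + (x + x)) '' ((⊥ : Subfield F) : Set F))).ncard := by
          have : ({x + x, x + y} : Set F).ncard = 2 :=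
            Set.ncard_pair (fun h => hxy (add_left_cancel h))
          rw [← this]
          refine Set.ncard_le_ncard ?_ (Set.toFinite _)
          rintro z (rfl | rfl)
          · exact ⟨mem_coe.2 (add_mem_add hx hx), 0, zero_mem _, by simp⟩
          · exact ⟨mem_coe.2 (add_mem_add hx hy), 1, one_mem _, by simp only; ring⟩
        have h5 : (2 : ℝ) ≤ Real.sqrt ((2 : ℕ) : ℝ) := le_trans (by exact_mod_cast h4) h3
        rw [Real.le_sqrt' (by norm_num)] at h5
        norm_num at h5
      have : (A.card : ℝ) ≤ 1 := by exact_mod_cast hA1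
      exact this.trans (one_le_pow₀ (by linarith))
    · have h := main_bound A M hA hS hE h2 hG
      calc _ ≤ _ := h
        _ ≤ 2 ^ 24 * (M / A.card) ^ 24 := by gcongr <;> norm_num
        _ = (2 * (M / A.card)) ^ 24 := by rw [mul_pow]
        _ ≤ _ := pow_le_pow_right₀ (by linarith) (by norm_num)
  have hroot : (A.card : ℝ) ^ ((1 : ℝ) / 42) ≤ 2 * (M / A.card) := by
    have h := Real.rpow_le_rpow (by linarith) key (by norm_num : (0 : ℝ) ≤ 1 / 42)
    refine h.trans (le_of_eq ?_)
    rw [← Real.rpow_natCast, ← Real.rpow_mul (by linarith)]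
    norm_num
  have e : (A.card : ℝ) ^ ((43 : ℝ) / 42) = A.card * (A.card : ℝ) ^ ((1 : ℝ) / 42) := by
    rw [show (43 : ℝ) / 42 = 1 + 1 / 42 by norm_num, Real.rpow_add (by linarith), Real.rpow_one]
  rw [e]
  calc _ ≤ 1 / 2 * ((A.card : ℝ) * (2 * (M / A.card))) := by gcongr
    _ = M := by field_simp
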